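/- arXiv:1910.01001 — 5 statements merged into one kernel-verified Lean document; each statement's English description precedes it below -/
import Mathlib

section
/- Let $a$ be a positive integer and $b$ an integer, and suppose $y > 0$ is a real number satisfying $\sum_{n \in \mathbb{Z}} (n^2 - a) e^{-2\pi y n^2} = 0$. Set $S_0 = \sum_{n \in \mathbb{Z}} e^{-2\pi y n^2}$ and $S_2 = \sum_{n \in \mathbb{Z}} (n^2 - a)^2 e^{-2\pi y n^2}$, and define $A = e^{2\pi a y} S_0$ and $B = e^{2\pi b y} \sqrt{\frac{S_0}{2\pi S_2}}$. Then $\lim_{n \to \infty} \frac{r_n(an+b)\sqrt{n}}{A^n} = B$. -/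
open Filter Real

/-- The number of representations of the integer `m` as a sum of `k` squares. -/
noncomputable def numReps (k : ℕ) (m : ℤ) : ℕ :=
  Nat.card {x : Fin k → ℤ // (∑ i, (x i) ^ 2) = m}

/-- The characteristic function of the integer-valued random variable `Y` with weights `p`. -/
noncomputable def weightedCharFun {ι : Type*} (p : ι → ℝ) (Y : ι → ℤ) (t : ℝ) : ℂ :=
  ∑' i, (p i : ℂ) * Complex.exp ((t * Y i : ℝ) * Complex.I)

section LocalLimit

variable {ι : Type*} {p : ι → ℝ} {Y : ι → ℤ}

lemma norm_weightedCharFun_term (hp : ∀ i, 0 ≤ p i) (Y : ι → ℤ) (t : ℝ) (i : ι) :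
    ‖(p i : ℂ) * Complex.exp ((t * Y i : ℝ) * Complex.I)‖ = p i := by
  rw [norm_mul, Complex.norm_exp_ofReal_mul_I, mul_one, Complex.norm_real, norm_of_nonneg (hp i)]

lemma summable_weightedCharFun_term (hp : ∀ i, 0 ≤ p i) (hs : Summable p) (Y : ι → ℤ) (t : ℝ) :
    Summable fun i => (p i : ℂ) * Complex.exp ((t * Y i : ℝ) * Complex.I) :=
  .of_norm (by simpa only [norm_weightedCharFun_term hp Y t] using hs)

lemma continuous_weightedCharFun (hp : ∀ i, 0 ≤ p i) (hs : Summable p) (Y : ι → ℤ) :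
    Continuous (weightedCharFun p Y) := by
  refine continuous_tsum (fun i => by fun_prop) hs fun i t => ?_
  exact (norm_weightedCharFun_term hp Y t i).le

lemma norm_add_mul_exp_le {x y t : ℝ} (hx : 0 < x) (hy : 0 < y) (ht : |t| ≤ π) :
    ‖(x : ℂ) + y * Complex.exp (t * Complex.I)‖ ≤
      x + y - 2 * x * y / ((x + y) * π ^ 2) * t ^ 2 := by
  have hcos := Real.cos_le_one_sub_mul_cos_sq ht
  have hM : 0 < x + y := by positivity
  have hπ := Real.pi_pos
  have ht2 : t ^ 2 ≤ π ^ 2 := sq_le_sq' (neg_le_of_abs_le ht) (le_of_abs_le ht)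
  have hle : 2 * x * y / ((x + y) * π ^ 2) * t ^ 2 ≤ x + y := by
    rw [div_mul_eq_mul_div, div_le_iff₀ (by positivity)]
    have h1 : 2 * x * y ≤ (x + y) * (x + y) := by nlinarith [sq_nonneg x, sq_nonneg y]
    calc 2 * x * y * t ^ 2 ≤ (x + y) * (x + y) * π ^ 2 := by gcongr
      _ = _ := by ring
  refine abs_le_of_sq_le_sq' ?_ (sub_nonneg.2 hle) |>.2
  rw [← Complex.normSq_eq_norm_sq, Complex.normSq_apply]
  simp only [Complex.add_re, Complex.add_im, Complex.mul_re, Complex.mul_im, Complex.ofReal_re,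
    Complex.ofReal_im, Complex.exp_ofReal_mul_I_re, Complex.exp_ofReal_mul_I_im]
  have hd : 2 * x * y / ((x + y) * π ^ 2) * t ^ 2 = x * y * (2 / π ^ 2 * t ^ 2) / (x + y) := by
    field_simp
  rw [hd]
  set d := 2 / π ^ 2 * t ^ 2
  set e := x * y * d / (x + y) with he
  have hMe : (x + y) * e = x * y * d := by rw [he]; field_simp
  have h3 : x * y * cos t ≤ x * y * (1 - d) := by gcongr
  have h4 : (x + (y * cos t - 0 * sin t)) * (x + (y * cos t - 0 * sin t)) +
      (0 + (y * sin t + 0 * cos t)) * (0 + (y * sin t + 0 * cos t)) =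
      x ^ 2 + y ^ 2 + 2 * (x * y * cos t) := by
    linear_combination y ^ 2 * Real.sin_sq_add_cos_sq t
  have h5 : (x + y - e) ^ 2 = (x + y) ^ 2 - 2 * (x * y * d) + e ^ 2 := by
    linear_combination -2 * hMe
  rw [h4, h5]
  nlinarith [sq_nonneg e]

lemma exists_norm_weightedCharFun_le (hp : ∀ i, 0 ≤ p i) (h1 : HasSum p 1) {i j : ι}
    (hi : 0 < p i) (hj : 0 < p j) (hij : Y j = Y i + 1) :
    ∃ c > 0, ∀ t : ℝ, |t| ≤ π → ‖weightedCharFun p Y t‖ ≤ exp (-c * t ^ 2) := by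
  classical
  refine ⟨2 * p i * p j / ((p i + p j) * π ^ 2), by positivity, fun t ht => ?_⟩
  have hne : i ≠ j := by rintro rfl; simp at hij
  have hs := summable_weightedCharFun_term hp h1.summable Y t
  have hbd : ‖∑' k : {k // k ∉ ({i, j} : Finset ι)},
      (p k : ℂ) * Complex.exp ((t * Y k : ℝ) * Complex.I)‖ ≤
      ∑' k : {k // k ∉ ({i, j} : Finset ι)}, p k := by
    refine tsum_of_norm_bounded (h1.summable.subtype _).hasSum fun k => ?_
    exact (norm_weightedCharFun_term hp Y t k).le
  have hsum := h1.summable.sum_add_tsum_subtype_compl {i, j}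
  rw [h1.tsum_eq, Finset.sum_pair hne] at hsum
  have hpair : ‖(p i : ℂ) * Complex.exp ((t * Y i : ℝ) * Complex.I) +
      (p j : ℂ) * Complex.exp ((t * Y j : ℝ) * Complex.I)‖ ≤
      p i + p j - 2 * p i * p j / ((p i + p j) * π ^ 2) * t ^ 2 := by
    convert norm_add_mul_exp_le hi hj ht using 1
    rw [hij]
    have : (p i : ℂ) * Complex.exp ((t * Y i : ℝ) * Complex.I) +
      (p j : ℂ) * Complex.exp ((t * (Y i + 1 : ℤ) : ℝ) * Complex.I) =
      (p i + p j * Complex.exp (t * Complex.I)) * Complex.exp ((t * Y i : ℝ) * Complex.I) := by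
      rw [add_mul, mul_assoc, ← Complex.exp_add]
      push_cast
      ring_nf
    rw [this, norm_mul, Complex.norm_exp_ofReal_mul_I, mul_one]
  rw [weightedCharFun, ← hs.sum_add_tsum_subtype_compl {i, j}, Finset.sum_pair hne]
  calc _ ≤ _ := norm_add_le _ _
    _ ≤ _ := add_le_add hpair hbd
    _ = -(2 * p i * p j / ((p i + p j) * π ^ 2)) * t ^ 2 + 1 := by linarith
    _ ≤ _ := Real.add_one_le_exp _

lemma norm_exp_mul_I_sub_one_sub_le (x : ℝ) :
    ‖Complex.exp (x * Complex.I) - 1 - x * Complex.I‖ ≤ 3 * x ^ 2 := by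
  have hn : ‖(x : ℂ) * Complex.I‖ = |x| := by simp
  rcases le_or_gt |x| 1 with h | h
  · have := Complex.norm_exp_sub_one_sub_id_le (x := x * Complex.I) (by rwa [hn])
    rw [hn, sq_abs] at this
    nlinarith [sq_nonneg x]
  · calc _ ≤ ‖Complex.exp (x * Complex.I)‖ + ‖(1 : ℂ)‖ + ‖(x : ℂ) * Complex.I‖ :=
        (norm_sub_le _ _).trans (by gcongr; exact norm_sub_le _ _)
      _ = 2 + |x| := by rw [hn, Complex.norm_exp_ofReal_mul_I]; norm_num
      _ ≤ _ := by nlinarith [sq_abs x]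

lemma tendsto_mul_exp_div_sqrt_sub (x : ℝ) :
    Tendsto (fun n : ℕ => (n : ℂ) * (Complex.exp ((x / √n : ℝ) * Complex.I) - 1 -
      (x / √n : ℝ) * Complex.I)) atTop (nhds (-(x ^ 2 / 2 : ℝ))) := by
  have h0 : Tendsto (fun n : ℕ => x / √(n : ℝ)) atTop (nhds 0) :=
    (Real.tendsto_sqrt_atTop.comp tendsto_natCast_atTop_atTop).const_div_atTop x
  rw [tendsto_iff_norm_sub_tendsto_zero]
  refine squeeze_zero' (g := fun n : ℕ => x ^ 2 * (|x / √(n : ℝ)| * exp |x / √(n : ℝ)|))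
    (.of_forall fun _ => norm_nonneg _) ?_ ?_
  · filter_upwards [eventually_gt_atTop 0] with n hn
    have hn' : (0 : ℝ) < n := by exact_mod_cast hn
    set s := x / √(n : ℝ) with hs
    have hns : n * s ^ 2 = x ^ 2 := by
      rw [hs, div_pow, Real.sq_sqrt hn'.le]; field_simp
    have hb := Complex.norm_exp_sub_sum_le_norm_mul_exp (s * Complex.I) 3
    have hnorm : ‖(s : ℂ) * Complex.I‖ = |s| := by simp
    rw [hnorm] at hb
    have heq : (n : ℂ) * (Complex.exp (s * Complex.I) - 1 - s * Complex.I) - -(x ^ 2 / 2 : ℝ) =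
        n * (Complex.exp (s * Complex.I) -
          ∑ m ∈ Finset.range 3, (s * Complex.I) ^ m / (m.factorial : ℂ)) := by
      rw [← hns]
      simp [Finset.sum_range_succ, mul_pow]
      ring
    rw [heq, norm_mul, Complex.norm_natCast]
    calc _ ≤ n * (|s| ^ 3 * exp |s|) := by gcongr
      _ = (n * s ^ 2) * (|s| * exp |s|) := by rw [← sq_abs s]; ring
      _ = _ := by rw [hns]
  · have := ((h0.abs.mul (Real.continuous_exp.tendsto _ |>.comp h0.abs)).const_mul (x ^ 2))
    simpa using this

lemma tendsto_weightedCharFun_div_sqrt_pow {v : ℝ} (hp : ∀ i, 0 ≤ p i) (h1 : HasSum p 1)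
    (h0 : HasSum (fun i => p i * Y i) 0) (h2 : HasSum (fun i => p i * (Y i : ℝ) ^ 2) v) (u : ℝ) :
    Tendsto (fun n : ℕ => weightedCharFun p Y (u / √n) ^ n) atTop
      (nhds (exp (-(v / 2) * u ^ 2) : ℝ)) := by
  have key : Tendsto (fun n : ℕ => (n : ℂ) * (weightedCharFun p Y (u / √n) - 1)) atTop
      (nhds ((-(v / 2) * u ^ 2 : ℝ) : ℂ)) := by
    have hlim : ∑' i, (p i : ℂ) * (-((u * Y i) ^ 2 / 2 : ℝ)) = ((-(v / 2) * u ^ 2 : ℝ) : ℂ) := by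
      rw [show -(v / 2) * u ^ 2 = -(u ^ 2 / 2) * v by ring,
      ← (h2.mul_left (-(u ^ 2 / 2))).tsum_eq, Complex.ofReal_tsum]
      refine tsum_congr fun i => ?_
      push_cast
      ring
    rw [← hlim]
    have hdom := tendsto_tsum_of_dominated_convergence (𝓕 := atTop)
      (f := fun (n : ℕ) i => (p i : ℂ) * ((n : ℂ) * (Complex.exp (((u * Y i) / √n : ℝ) * Complex.I)
        - 1 - ((u * Y i) / √n : ℝ) * Complex.I)))
      (bound := fun i => 3 * u ^ 2 * (p i * (Y i : ℝ) ^ 2))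
      (h2.summable.mul_left _) (fun i => (tendsto_mul_exp_div_sqrt_sub (u * Y i)).const_mul _) ?_
    · refine hdom.congr fun n => ?_
      have e1 := (summable_weightedCharFun_term hp h1.summable Y (u / √n)).hasSum
      have e2 := Complex.hasSum_ofReal.2 h1
      have e3 := (Complex.hasSum_ofReal.2 h0).mul_left ((u / √n : ℝ) * Complex.I)
      have e4 := ((e1.sub e2).sub e3).mul_left (n : ℂ)
      rw [weightedCharFun]
      convert! e4.tsum_eq using 1
      · refine tsum_congr fun i => ?_
        rw [mul_div_right_comm]
        push_cast
        ring
      · push_cast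
        ring
    · filter_upwards [eventually_gt_atTop 0] with n hn i
      have hn' : (0 : ℝ) < n := by exact_mod_cast hn
      rw [norm_mul, norm_mul, Complex.norm_real, norm_of_nonneg (hp i), Complex.norm_natCast]
      calc _ ≤ p i * (n * (3 * (u * Y i / √n) ^ 2)) := by
            gcongr
            · exact hp i
            · exact norm_exp_mul_I_sub_one_sub_le _
        _ = _ := by
            rw [div_pow, Real.sq_sqrt hn'.le]
            field_simp
  have := Complex.tendsto_one_add_pow_exp_of_tendsto key
  rw [Complex.ofReal_exp]
  refine this.congr fun n => ?_
  rw [add_sub_cancel]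

lemma hasSum_prod_fin {f : ι → ℂ} (hf : Summable fun i => ‖f i‖) (n : ℕ) :
    (Summable fun x : Fin n → ι => ‖∏ k, f (x k)‖) ∧
      HasSum (fun x : Fin n → ι => ∏ k, f (x k)) ((∑' i, f i) ^ n) := by
  induction n with
  | zero => exact ⟨(hasSum_fintype _).summable, by simp [hasSum_unique]⟩
  | succ n ih =>
    have hsm : Summable fun z : ι × (Fin n → ι) => ‖f z.1 * ∏ k, f (z.2 k)‖ :=
      Summable.mul_norm (f := f) (g := fun x : Fin n → ι => ∏ k, f (x k)) hf ih.1
    have hcons (z : ι × (Fin n → ι)) :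
        ∏ k, f (Fin.consEquiv (fun _ => ι) z k) = f z.1 * ∏ k, f (z.2 k) := by
      simp [Fin.prod_univ_succ, Fin.consEquiv]
    constructor
    · rw [← (Fin.consEquiv fun _ => ι).summable_iff]
      exact hsm.congr fun z => by rw [Function.comp_apply, hcons]
    · rw [← (Fin.consEquiv fun _ => ι).hasSum_iff, pow_succ', ← ih.2.tsum_eq,
        tsum_mul_tsum_of_summable_norm hf ih.1]
      exact hsm.of_norm.hasSum.congr_fun hcons

lemma integral_exp_int_mul_I (m : ℤ) :
    ∫ t in -π..π, Complex.exp ((t * m : ℝ) * Complex.I) = if m = 0 then (2 * π : ℂ) else 0 := by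
  split_ifs with h
  · simp [h]
    ring
  · have hm : (m : ℂ) * Complex.I ≠ 0 := by simp [h]
    have := integral_exp_mul_complex (a := -π) (b := π) hm
    have hper : Complex.exp (m * Complex.I * (π : ℝ)) =
        Complex.exp (m * Complex.I * (-π : ℝ)) := by
      rw [Complex.exp_eq_exp_iff_exists_int]
      exact ⟨m, by push_cast; ring⟩
    rw [hper, sub_self, zero_div] at this
    rw [← this]
    refine intervalIntegral.integral_congr fun t _ => ?_
    push_cast
    ring_nf

/-- Fourier inversion for an integer-valued random variable. -/
lemma hasSum_weight_fiber [Countable ι] (hp : ∀ i, 0 ≤ p i) (hs : Summable p) (b : ℤ) :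
    HasSum (fun i : {i // Y i = b} => (p i : ℂ))
      ((2 * π : ℂ)⁻¹ * ∫ t in -π..π,
        weightedCharFun p Y t * Complex.exp ((t * -b : ℝ) * Complex.I)) := by
  have hint := intervalIntegral.hasSum_integral_of_dominated_convergence (a := -π) (b := π)
    (μ := MeasureTheory.volume)
    (F := fun (i : ι) (t : ℝ) => (p i : ℂ) * Complex.exp ((t * (Y i - b : ℤ) : ℝ) * Complex.I))
    (f := fun t => weightedCharFun p Y t * Complex.exp ((t * -b : ℝ) * Complex.I))
    (fun i _ => p i)
    (fun i => Continuous.aestronglyMeasurable (by fun_prop))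
    (fun i => .of_forall fun t _ =>
      (norm_weightedCharFun_term hp (fun i => Y i - b) t i).le)
    (.of_forall fun _ _ => hs) intervalIntegrable_const
    (.of_forall fun t _ => by
      have h := (summable_weightedCharFun_term hp hs Y t).hasSum.mul_right
        (Complex.exp ((t * -b : ℝ) * Complex.I))
      refine h.congr_fun fun i => ?_
      rw [mul_assoc, ← Complex.exp_add]
      push_cast
      ring_nf)
  simp only [intervalIntegral.integral_const_mul, integral_exp_int_mul_I] at hint
  have h := hint.mul_left (2 * π : ℂ)⁻¹
  refine (hasSum_subtype_iff_indicator (s := {i | Y i = b})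
    (f := fun i => (p i : ℂ))).2 (h.congr_fun fun i => ?_)
  have hπ : (π : ℂ) ≠ 0 := by exact_mod_cast Real.pi_ne_zero
  by_cases hx : Y i = b
  · rw [Set.indicator_of_mem (by exact hx), if_pos (by omega)]
    field_simp
  · rw [Set.indicator_of_notMem (by exact hx), if_neg (by omega)]
    simp

lemma summable_prod_weight (hp : ∀ i, 0 ≤ p i) (hs : Summable p) (n : ℕ) :
    Summable fun x : Fin n → ι => ∏ k, p (x k) := by
  have := (hasSum_prod_fin (f := fun i => (p i : ℂ)) (by simpa using hs.norm) n).1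
  refine this.congr fun x => ?_
  rw [norm_prod]
  exact Finset.prod_congr rfl fun k _ => by rw [Complex.norm_real, norm_of_nonneg (hp _)]

lemma weightedCharFun_prod (hp : ∀ i, 0 ≤ p i) (hs : Summable p) (Y : ι → ℤ) (n : ℕ) (t : ℝ) :
    weightedCharFun (fun x : Fin n → ι => ∏ k, p (x k)) (fun x => ∑ k, Y (x k)) t =
      weightedCharFun p Y t ^ n := by
  rw [weightedCharFun, weightedCharFun,
    ← (hasSum_prod_fin (summable_weightedCharFun_term hp hs Y t).norm n).2.tsum_eq]
  refine tsum_congr fun x => ?_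
  rw [Finset.prod_mul_distrib, ← Complex.exp_sum, ← Finset.sum_mul]
  push_cast
  rw [← Finset.mul_sum]

/-- **Local limit theorem** for sums of independent copies of a centred integer-valued random
variable `Y` of variance `v` which takes two consecutive values. -/
theorem tendsto_sqrt_mul_tsum_prod_weight [Countable ι] {v : ℝ} (hp : ∀ i, 0 ≤ p i)
    (h1 : HasSum p 1) (h0 : HasSum (fun i => p i * Y i) 0)
    (h2 : HasSum (fun i => p i * (Y i : ℝ) ^ 2) v) (hv : 0 < v) {i j : ι}
    (hi : 0 < p i) (hj : 0 < p j) (hij : Y j = Y i + 1) (b : ℤ) :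
    Tendsto (fun n : ℕ => √n * ∑' x : {x : Fin n → ι // ∑ k, Y (x k) = b}, ∏ k, p (x.1 k))
      atTop (nhds (√(2 * π * v))⁻¹) := by
  obtain ⟨c, hc, hbd⟩ := exists_norm_weightedCharFun_le hp h1 hi hj hij
  have hcont := continuous_weightedCharFun hp h1.summable Y
  set G : ℕ → ℝ → ℂ := fun n t =>
    weightedCharFun p Y t ^ n * Complex.exp ((t * -b : ℝ) * Complex.I) with hG
  have hGc (n : ℕ) : Continuous (G n) := by fun_prop
  have hlim : Tendsto (fun n : ℕ => ∫ u : ℝ,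
      (Set.Ioc (-(π * √n)) (π * √n)).indicator (fun u => G n (u / √n)) u) atTop
      (nhds (∫ u : ℝ, ((exp (-(v / 2) * u ^ 2) : ℝ) : ℂ))) := by
    refine MeasureTheory.tendsto_integral_filter_of_dominated_convergence
      (fun u => exp (-c * u ^ 2)) ?_ ?_ (integrable_exp_neg_mul_sq hc) ?_
    · refine .of_forall fun n => ?_
      exact (Continuous.aestronglyMeasurable (by fun_prop)).indicator measurableSet_Ioc
    · filter_upwards [eventually_gt_atTop 0] with n hn
      refine .of_forall fun u => ?_
      by_cases hu : u ∈ Set.Ioc (-(π * √n)) (π * √n)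
      · have hn' : (0 : ℝ) < n := by exact_mod_cast hn
        have hsq : 0 < √(n : ℝ) := Real.sqrt_pos.2 hn'
        rw [Set.indicator_of_mem hu, hG]
        simp only
        rw [norm_mul, Complex.norm_exp_ofReal_mul_I, mul_one, norm_pow]
        have hle : |u / √n| ≤ π := by
          rw [abs_div, abs_of_pos hsq, div_le_iff₀ hsq, abs_le]
          exact ⟨hu.1.le, hu.2⟩
        calc _ ≤ exp (-c * (u / √n) ^ 2) ^ n := by gcongr; exact hbd _ hle
          _ = _ := by
            rw [← Real.exp_nat_mul, div_pow, Real.sq_sqrt hn'.le]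
            congr 1
            field_simp
      · rw [Set.indicator_of_notMem hu, norm_zero]
        positivity
    · refine .of_forall fun u => ?_
      have hs : Tendsto (fun n : ℕ => √(n : ℝ)) atTop atTop :=
        Real.tendsto_sqrt_atTop.comp tendsto_natCast_atTop_atTop
      have hexp : Tendsto (fun n : ℕ => Complex.exp ((u / √n * -b : ℝ) * Complex.I)) atTop
          (nhds 1) := by
        have hz : Tendsto (fun n : ℕ => u / √(n : ℝ)) atTop (nhds 0) := hs.const_div_atTop u
        have hc' : Continuous fun s : ℝ => Complex.exp ((s * -b : ℝ) * Complex.I) := by fun_prop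
        have := (hc'.tendsto 0).comp hz
        rw [zero_mul, Complex.ofReal_zero, zero_mul, Complex.exp_zero] at this
        exact this
      have := (tendsto_weightedCharFun_div_sqrt_pow hp h1 h0 h2 u).mul hexp
      rw [mul_one] at this
      refine this.congr' ?_
      filter_upwards [(hs.const_mul_atTop Real.pi_pos).eventually_gt_atTop |u|] with n hn
      have hu : u ∈ Set.Ioc (-(π * √n)) (π * √n) := ⟨(abs_lt.1 hn).1, (abs_lt.1 hn).2.le⟩
      rw [Set.indicator_of_mem hu]
  rw [integral_complex_ofReal, integral_gaussian] at hlim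
  have hmul := hlim.const_mul (2 * π : ℂ)⁻¹
  have hval : (2 * π : ℂ)⁻¹ * (√(π / (v / 2)) : ℝ) = ((√(2 * π * v))⁻¹ : ℝ) := by
    have : (2 * π)⁻¹ * √(π / (v / 2)) = (√(2 * π * v))⁻¹ := by
      rw [← Real.sqrt_inv, eq_comm, Real.sqrt_eq_iff_mul_self_eq_of_pos]
      · rw [mul_mul_mul_comm, Real.mul_self_sqrt (by positivity)]
        field_simp
      · positivity
    exact_mod_cast this
  rw [hval] at hmul
  have hre := (Complex.continuous_re.tendsto _).comp hmul
  rw [Complex.ofReal_re] at hre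
  refine hre.congr' ?_
  filter_upwards [eventually_gt_atTop 0] with n hn
  have hn' : (0 : ℝ) < n := by exact_mod_cast hn
  have hsq : 0 < √(n : ℝ) := Real.sqrt_pos.2 hn'
  have hsum := (hasSum_weight_fiber (Y := fun x : Fin n → ι => ∑ k, Y (x k))
    (fun x => Finset.prod_nonneg fun k _ => hp (x k))
    (summable_prod_weight hp h1.summable n) b).tsum_eq
  simp only [weightedCharFun_prod hp h1.summable] at hsum
  rw [← Complex.ofReal_tsum] at hsum
  have hscale : ∫ u : ℝ, (Set.Ioc (-(π * √n)) (π * √n)).indicator (fun u => G n (u / √n)) u =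
      √n * ∫ t in -π..π, G n t := by
    rw [MeasureTheory.integral_indicator measurableSet_Ioc,
      ← intervalIntegral.integral_of_le (by nlinarith [Real.pi_pos]),
      intervalIntegral.integral_comp_div _ hsq.ne', Complex.real_smul, neg_div,
      mul_div_cancel_right₀ _ hsq.ne']
  rw [Function.comp_apply, hscale, mul_left_comm, ← hsum, Complex.re_ofReal_mul,
    Complex.ofReal_re]

end LocalLimit

lemma summable_pow_mul_theta_weight {y : ℝ} (hy : 0 < y) (k : ℕ) :
    Summable fun n : ℤ => ((n : ℝ) ^ 2) ^ k * exp (-2 * π * y * (n : ℝ) ^ 2) := by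
  refine (summable_pow_mul_jacobiTheta₂_term_bound 0 (by positivity : 0 < 2 * y) (2 * k)).congr
    fun n => ?_
  rw [pow_mul, Int.cast_abs, sq_abs]
  ring_nf

/-- The local probabilities of the theta weights count representations by squares. -/
lemma tsum_prod_theta_weight_eq_numReps {y : ℝ} (s : ℝ) (n : ℕ) (a b : ℤ) :
    ∑' x : {x : Fin n → ℤ // ∑ k, ((x k) ^ 2 - a) = b},
      ∏ k, (exp (-2 * π * y * (x.1 k : ℝ) ^ 2) / s) =
    numReps n (a * n + b) * (exp (-2 * π * y * (a * n + b)) / s ^ n) := by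
  have hterm (x : {x : Fin n → ℤ // ∑ k, ((x k) ^ 2 - a) = b}) :
      ∏ k, (exp (-2 * π * y * (x.1 k : ℝ) ^ 2) / s) =
        exp (-2 * π * y * (a * n + b)) / s ^ n := by
    have hx : ∑ k, (x.1 k : ℝ) ^ 2 = a * n + b := by
      have := x.2
      rw [Finset.sum_sub_distrib] at this
      simp only [Finset.sum_const, Finset.card_univ, Fintype.card_fin, nsmul_eq_mul] at this
      have h : ∑ k, x.1 k ^ 2 = a * n + b := by linarith
      exact_mod_cast h
    rw [Finset.prod_div_distrib, ← Real.exp_sum, ← Finset.mul_sum, hx]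
    simp
  simp_rw [hterm]
  rw [tsum_const, nsmul_eq_mul, numReps]
  congr 2
  refine Nat.card_congr (Equiv.subtypeEquivRight fun x => ?_)
  rw [Finset.sum_sub_distrib]
  simp only [Finset.sum_const, Finset.card_univ, Fintype.card_fin, nsmul_eq_mul]
  constructor <;> intro h <;> linarith

theorem rep_growing_asymptotic_explicit (a : ℤ) (ha : 0 < a) (b : ℤ)
    (y : ℝ) (hy : 0 < y)
    (hcrit : (∑' n : ℤ, ((n : ℝ) ^ 2 - a) * Real.exp (-2 * π * y * (n : ℝ) ^ 2)) = 0)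
    (S0 S2 A B : ℝ)
    (hS0 : S0 = ∑' n : ℤ, Real.exp (-2 * π * y * (n : ℝ) ^ 2))
    (hS2 : S2 = ∑' n : ℤ, ((n : ℝ) ^ 2 - a) ^ 2 * Real.exp (-2 * π * y * (n : ℝ) ^ 2))
    (hA : A = Real.exp (2 * π * a * y) * S0)
    (hB : B = Real.exp (2 * π * b * y) * Real.sqrt (S0 / (2 * π * S2))) :
    Tendsto (fun n : ℕ => (numReps n (a * n + b) : ℝ) * Real.sqrt n / A ^ n)
      atTop (nhds B) := by
  have hs0 := summable_pow_mul_theta_weight hy 0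
  have hs1 := summable_pow_mul_theta_weight hy 1
  have hs2 := summable_pow_mul_theta_weight hy 2
  simp only [pow_zero, one_mul, pow_one] at hs0 hs1
  have ht1 : Summable fun n : ℤ => ((n : ℝ) ^ 2 - a) * exp (-2 * π * y * (n : ℝ) ^ 2) :=
    (hs1.sub (hs0.mul_left (a : ℝ))).congr fun n => by ring
  have ht2 : Summable fun n : ℤ => ((n : ℝ) ^ 2 - a) ^ 2 * exp (-2 * π * y * (n : ℝ) ^ 2) :=
    ((hs2.sub (hs1.mul_left (2 * a : ℝ))).add (hs0.mul_left ((a : ℝ) ^ 2))).congr fun n => by ring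
  have hS0pos : 0 < S0 := hS0 ▸ hs0.tsum_pos (fun _ => (exp_pos _).le) 0 (exp_pos _)
  have hS2pos : 0 < S2 := hS2 ▸ ht2.tsum_pos (fun _ => by positivity) 0 (by
    have : (a : ℝ) ≠ 0 := by exact_mod_cast ha.ne'
    simp; positivity)
  have h1 := hs0.hasSum.div_const S0
  rw [← hS0, div_self hS0pos.ne'] at h1
  have h0 := ht1.hasSum.div_const S0
  rw [hcrit, zero_div] at h0
  have h2 := ht2.hasSum.div_const S0
  rw [← hS2] at h2
  have hlim := tendsto_sqrt_mul_tsum_prod_weight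
    (p := fun n : ℤ => exp (-2 * π * y * (n : ℝ) ^ 2) / S0) (Y := fun n : ℤ => n ^ 2 - a)
    (v := S2 / S0) (fun n => by positivity) h1
    (h0.congr_fun fun n => by push_cast; ring) (h2.congr_fun fun n => by push_cast; ring)
    (by positivity) (i := 0) (j := 1) (by positivity) (by positivity) (by ring) b
  simp only [tsum_prod_theta_weight_eq_numReps] at hlim
  have hlim' := hlim.const_mul (exp (2 * π * b * y))
  have hBeq : B = exp (2 * π * b * y) * (√(2 * π * (S2 / S0)))⁻¹ := by
    rw [hB, ← Real.sqrt_inv, mul_div_assoc', inv_div]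
  rw [hBeq]
  refine hlim'.congr fun n => ?_
  have hexp : exp (-2 * π * y * (a * n + b)) =
      (exp (2 * π * b * y))⁻¹ * (exp (2 * π * a * y) ^ n)⁻¹ := by
    rw [← Real.exp_nat_mul, ← Real.exp_neg, ← Real.exp_neg, ← Real.exp_add]
    ring_nf
  rw [hexp, hA, mul_pow]
  field_simp
end

section
/- There exists a real constant $A$ with $4.132 < A < 4.134$ such that $\lim_{n \to \infty} r_n(n)^{1/n} = A$. -/
open Filter

theorem abs_le_of_sum_sq_eq {ι : Type*} [Fintype ι] {m : ℕ} {x : ι → ℤ}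
    (hx : ∑ i, x i ^ 2 = (m : ℤ)) (i : ι) : |x i| ≤ m := by
  have h1 : x i ^ 2 ≤ ∑ i, x i ^ 2 :=
    Finset.single_le_sum (f := fun i => x i ^ 2) (fun j _ => sq_nonneg _) (Finset.mem_univ i)
  have h2 : |x i| ≤ x i ^ 2 := by
    rw [← sq_abs]
    exact Int.le_self_sq _
  exact h2.trans (h1.trans hx.le)

theorem finite_sum_sq_eq {ι : Type*} [Fintype ι] (m : ℕ) :
    Finite {x : ι → ℤ // ∑ i, x i ^ 2 = (m : ℤ)} := by
  classical
  refine Set.Finite.subset (Set.finite_Icc (fun _ : ι => -(m : ℤ)) (fun _ => (m : ℤ))) ?_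
  intro x hx
  exact ⟨fun i => (abs_le.1 (abs_le_of_sum_sq_eq hx i)).1,
    fun i => (abs_le.1 (abs_le_of_sum_sq_eq hx i)).2⟩

theorem numReps_mul_le (a b c d : ℕ) :
    numReps a c * numReps b d ≤ numReps (a + b) ((c + d : ℕ) : ℤ) := by
  have := finite_sum_sq_eq (ι := Fin (a + b)) (c + d)
  unfold numReps
  rw [← Nat.card_prod]
  refine Nat.card_le_card_of_injective (fun p => ⟨Fin.append p.1.1 p.2.1, ?_⟩) ?_
  · simp [Fin.sum_univ_add, p.1.2, p.2.2]
  · rintro ⟨⟨x, hx⟩, ⟨y, hy⟩⟩ ⟨⟨x', hx'⟩, ⟨y', hy'⟩⟩ h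
    simp only [Subtype.mk.injEq] at h
    simp only [Prod.mk.injEq, Subtype.mk.injEq]
    constructor
    · ext i
      simpa using congrFun h (Fin.castAdd b i)
    · ext i
      simpa using congrFun h (Fin.natAdd a i)

theorem numReps_self_pos (n : ℕ) : 0 < numReps n n := by
  have := finite_sum_sq_eq (ι := Fin n) n
  have : Nonempty {x : Fin n → ℤ // ∑ i, x i ^ 2 = (n : ℤ)} := ⟨⟨fun _ => 1, by simp⟩⟩
  exact Nat.card_pos

theorem numReps_eq_card_of_card_eq {α : Type*} [Fintype α] {n : ℕ} (h : Fintype.card α = n)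
    (m : ℤ) : numReps n m = Nat.card {x : α → ℤ // ∑ i, x i ^ 2 = m} := by
  let e : Fin n ≃ α := (Fintype.equivFinOfCardEq h).symm
  refine Nat.card_congr (Equiv.subtypeEquiv (Equiv.arrowCongr e (Equiv.refl ℤ)) fun x => ?_)
  rw [← Equiv.sum_comp e]
  simp

/-- Permuting the coordinates of one representation that takes the value `v i` exactly `k i` times
produces a multinomial coefficient's worth of representations. -/
theorem factorial_le_numReps_mul {ι : Type*} [Fintype ι] [DecidableEq ι] (k : ι → ℕ) (v : ι → ℤ)
    (hv : Function.Injective v) (n m : ℕ) (hn : ∑ i, k i = n) (hm : ∑ i, k i * v i ^ 2 = (m : ℤ)) :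
    n.factorial ≤ numReps n m * ∏ i, (k i).factorial := by
  classical
  let α := Σ i, Fin (k i)
  have hα : Fintype.card α = n := by simp [α, hn]
  rw [numReps_eq_card_of_card_eq hα]
  have := finite_sum_sq_eq (ι := α) m
  let _ := Fintype.ofFinite {x : α → ℤ // ∑ i, x i ^ 2 = (m : ℤ)}
  rw [Nat.card_eq_fintype_card, ← hα, ← Fintype.card_perm, mul_comm]
  let f : Equiv.Perm α → {x : α → ℤ // ∑ i, x i ^ 2 = (m : ℤ)} := fun σ =>
    ⟨fun a => v (σ a).1, by
      rw [Equiv.sum_comp σ (fun a : α => v a.1 ^ 2), Fintype.sum_sigma]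
      simpa using hm⟩
  refine Finset.card_le_mul_card_image_of_maps_to (f := f) (t := Finset.univ)
    (s := Finset.univ) (by simp) _ ?_
  intro b _
  by_cases hb : ∃ σ₀, f σ₀ = b
  · obtain ⟨σ₀, rfl⟩ := hb
    have h := DomMulAct.stabilizer_card (Sigma.fst : α → ι)
    have h' : ∀ i, Fintype.card {a : α // a.1 = i} = k i := fun i => by
      rw [Fintype.card_congr (Equiv.sigmaSubtype i)]
      simp
    rw [Finset.prod_congr rfl fun i _ => congrArg Nat.factorial (h' i)] at h
    rw [← h, ← Fintype.card_coe]
    refine Fintype.card_le_of_injective (fun σ => ⟨σ.1 * σ₀⁻¹, ?_⟩) ?_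
    · have h2 := (Finset.mem_filter.1 σ.2).2
      ext a
      have := congrFun (Subtype.ext_iff.1 h2) (σ₀⁻¹ a)
      simpa [f] using hv this
    · intro σ τ h
      exact Subtype.ext (mul_right_cancel (Subtype.ext_iff.1 h))
  · rw [Finset.filter_false_of_mem (fun σ _ h => hb ⟨σ, h⟩)]
    simp

theorem numReps_mul_pow_le {q C : ℝ} (hq : 0 < q) (n m : ℕ)
    (hC : ∑ x ∈ Finset.Icc (-(m : ℤ)) m, q ^ (x.natAbs ^ 2) ≤ C) :
    numReps n m * q ^ m ≤ C ^ n := by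
  classical
  have hcard : numReps n m = ((Fintype.piFinset fun _ : Fin n =>
      Finset.Icc (-(m : ℤ)) m).filter fun x => ∑ i, x i ^ 2 = (m : ℤ)).card := by
    rw [numReps, ← Nat.card_eq_finsetCard]
    refine Nat.card_congr (Equiv.subtypeEquivRight fun x => ?_)
    simp only [Finset.mem_filter, Fintype.mem_piFinset, Finset.mem_Icc, iff_and_self]
    exact fun hx i => abs_le.1 (abs_le_of_sum_sq_eq hx i)
  calc (numReps n m : ℝ) * q ^ m
      = ∑ x ∈ (Fintype.piFinset fun _ : Fin n => Finset.Icc (-(m : ℤ)) m).filter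
          fun x => ∑ i, x i ^ 2 = (m : ℤ), ∏ i, q ^ ((x i).natAbs ^ 2) := by
        rw [hcard, ← nsmul_eq_mul]
        refine (Finset.sum_eq_card_nsmul fun x hx => ?_).symm
        rw [Finset.prod_pow_eq_pow_sum]
        congr 1
        have := (Finset.mem_filter.1 hx).2
        zify
        simpa using this
    _ ≤ ∑ x ∈ Fintype.piFinset fun _ : Fin n => Finset.Icc (-(m : ℤ)) m,
          ∏ i, q ^ ((x i).natAbs ^ 2) :=
        Finset.sum_le_sum_of_subset_of_nonneg (Finset.filter_subset _ _)
          fun _ _ _ => by positivity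
    _ = (∑ x ∈ Finset.Icc (-(m : ℤ)) m, q ^ (x.natAbs ^ 2)) ^ n := by rw [Finset.sum_pow']
    _ ≤ C ^ n := pow_le_pow_left₀ (Finset.sum_nonneg fun _ _ => by positivity) hC n

theorem sum_Icc_natAbs (g : ℕ → ℝ) (n : ℕ) :
    ∑ x ∈ Finset.Icc (-(n : ℤ)) n, g x.natAbs = g 0 + 2 * ∑ j ∈ Finset.range n, g (j + 1) := by
  induction n with
  | zero => simp
  | succ n ih =>
    have : Finset.Icc (-((n + 1 : ℕ) : ℤ)) ((n + 1 : ℕ) : ℤ) =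
        insert (-((n + 1 : ℕ) : ℤ)) (insert ((n + 1 : ℕ) : ℤ) (Finset.Icc (-(n : ℤ)) n)) := by
      ext x
      simp only [Finset.mem_Icc, Finset.mem_insert]
      omega
    rw [this, Finset.sum_insert, Finset.sum_insert, ih, Finset.sum_range_succ]
    · simp only [Int.natAbs_neg, Int.natAbs_natCast]
      ring
    · simp
    · simp only [Finset.mem_Icc, Finset.mem_insert]
      omega

theorem sum_three_fifths_pow_sq_le (n : ℕ) :
    ∑ x ∈ Finset.Icc (-(n : ℤ)) n, (3 / 5 : ℝ) ^ (x.natAbs ^ 2) ≤ 2.48 := by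
  rw [sum_Icc_natAbs (fun j => (3 / 5 : ℝ) ^ (j ^ 2))]
  have h1 : ∑ j ∈ Finset.range n, (3 / 5 : ℝ) ^ ((j + 1) ^ 2) ≤
      ∑ j ∈ Finset.range (n + 3), (3 / 5 : ℝ) ^ ((j + 1) ^ 2) :=
    Finset.sum_le_sum_of_subset_of_nonneg (Finset.range_mono (by omega)) fun _ _ _ => by positivity
  have h2 : ∑ j ∈ Finset.range n, (3 / 5 : ℝ) ^ ((j + 3 + 1) ^ 2) ≤
      (3 / 5 : ℝ) ^ 16 * (1 - (3 / 5 : ℝ) ^ 8)⁻¹ := by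
    calc _ ≤ ∑ j ∈ Finset.range n, (3 / 5 : ℝ) ^ 16 * ((3 / 5 : ℝ) ^ 8) ^ j := by
          refine Finset.sum_le_sum fun j _ => ?_
          rw [← pow_mul, ← pow_add]
          exact pow_le_pow_of_le_one (by norm_num) (by norm_num) (by nlinarith)
      _ ≤ _ := by
          rw [← Finset.mul_sum]
          refine mul_le_mul_of_nonneg_left ?_ (by positivity)
          rw [← tsum_geometric_of_lt_one (by positivity) (by norm_num)]
          exact (summable_geometric_of_lt_one (by positivity) (by norm_num)).sum_le_tsum _
            fun _ _ => by positivity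
  rw [Finset.sum_range_succ', Finset.sum_range_succ', Finset.sum_range_succ'] at h1
  norm_num at h1 h2 ⊢
  linarith

theorem factorial_mul_exp_le {n : ℕ} (hn : n ≠ 0) :
    n.factorial * Real.exp n ≤ Real.exp 1 * n * (n : ℝ) ^ n := by
  induction n, Nat.one_le_iff_ne_zero.2 hn using Nat.le_induction with
  | base => simp
  | succ n hn' ih =>
    have ih := ih (by omega)
    have hpos : (0 : ℝ) < n := by exact_mod_cast hn'
    have key : Real.exp 1 * (n : ℝ) ^ (n + 1) ≤ ((n : ℝ) + 1) ^ (n + 1) := by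
      have h1 : Real.exp (1 / (n + 1)) ≤ ((n : ℝ) + 1) / n := by
        rw [← Real.le_log_iff_exp_le (by positivity)]
        have := Real.one_sub_inv_le_log_of_pos (x := ((n : ℝ) + 1) / n) (by positivity)
        refine le_trans (le_of_eq ?_) this
        field_simp
        ring
      have h2 := pow_le_pow_left₀ (Real.exp_pos _).le h1 (n + 1)
      rw [← Real.exp_nat_mul, div_pow, le_div_iff₀ (by positivity)] at h2
      rwa [Nat.cast_succ, mul_one_div_cancel (by positivity)] at h2
    rw [Nat.factorial_succ]
    push_cast
    rw [Real.exp_add]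
    calc ((n : ℝ) + 1) * n.factorial * (Real.exp n * Real.exp 1)
        = (n + 1) * Real.exp 1 * (n.factorial * Real.exp n) := by ring
      _ ≤ (n + 1) * Real.exp 1 * (Real.exp 1 * n * (n : ℝ) ^ n) := by gcongr
      _ = (n + 1) * Real.exp 1 * (Real.exp 1 * (n : ℝ) ^ (n + 1)) := by ring
      _ ≤ (n + 1) * Real.exp 1 * ((n : ℝ) + 1) ^ (n + 1) := by gcongr
      _ = _ := by ring

/-- Entropy lower bound for the growth rate of `numReps n n`, from the type with `k i` coordinates
equal to `v i`. -/
theorem pow_le_of_numReps_self_le {ι : Type*} [Fintype ι] [DecidableEq ι] (k : ι → ℕ) (v : ι → ℤ)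
    (hv : Function.Injective v) (hk : ∀ i, k i ≠ 0) (N : ℕ) (hN : ∑ i, k i = N)
    (hsq : ∑ i, k i * v i ^ 2 = (N : ℤ)) {A : ℝ} (hA : 0 < A)
    (hle : ∀ n, (numReps n n : ℝ) ≤ A ^ n) :
    (N : ℝ) ^ N ≤ A ^ N * ∏ i, (k i : ℝ) ^ k i := by
  set P : ℝ := A ^ N * ∏ i, (k i : ℝ) ^ k i with hP
  have hPpos : 0 < P := by
    have : ∀ i, (0 : ℝ) < k i := fun i => by exact_mod_cast Nat.pos_of_ne_zero (hk i)
    have := Finset.prod_pos fun i (_ : i ∈ Finset.univ) => pow_pos (this i) (k i)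
    positivity
  set c := Fintype.card ι
  set D : ℝ := ∏ i, (Real.exp 1 * k i)
  have main : ∀ s : ℕ, s ≠ 0 → ((N : ℝ) ^ N) ^ s ≤ P ^ s * (D * (s : ℝ) ^ c) := by
    intro s hs
    have hspos : (0 : ℝ) < s := by exact_mod_cast Nat.pos_of_ne_zero hs
    have h1 := factorial_le_numReps_mul (fun i => k i * s) v hv (N * s) (N * s)
      (by rw [← Finset.sum_mul, hN]) (by
        push_cast
        rw [← hsq, Finset.sum_mul]
        exact Finset.sum_congr rfl fun i _ => by ring)
    have h1' : ((N * s).factorial : ℝ) ≤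
        numReps (N * s) ((N * s : ℕ) : ℤ) * ∏ i, ((k i * s).factorial : ℝ) := by
      exact_mod_cast h1
    have h2 : (((N * s : ℕ) : ℝ)) ^ (N * s) ≤ (N * s).factorial * Real.exp ((N * s : ℕ) : ℝ) := by
      have := Real.pow_div_factorial_le_exp (x := ((N * s : ℕ) : ℝ)) (by positivity) (N * s)
      rwa [div_le_iff₀ (by positivity), mul_comm (Real.exp _)] at this
    have h3 : Real.exp ((N * s : ℕ) : ℝ) = ∏ i, Real.exp ((k i * s : ℕ) : ℝ) := by
      rw [← Real.exp_sum, ← hN, Finset.sum_mul]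
      push_cast
      rfl
    have h4 : ∏ i, (((k i * s).factorial : ℝ) * Real.exp ((k i * s : ℕ) : ℝ)) ≤
        ∏ i, (Real.exp 1 * ((k i * s : ℕ) : ℝ) * ((k i * s : ℕ) : ℝ) ^ (k i * s)) :=
      Finset.prod_le_prod (fun _ _ => by positivity)
        fun i _ => factorial_mul_exp_le (mul_ne_zero (hk i) hs)
    have h5 : ∏ i, (Real.exp 1 * ((k i * s : ℕ) : ℝ) * ((k i * s : ℕ) : ℝ) ^ (k i * s)) =
        (D * (s : ℝ) ^ c) * ((∏ i, (k i : ℝ) ^ k i) ^ s * (s : ℝ) ^ (N * s)) := by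
      have : (s : ℝ) ^ (N * s) = ∏ i, (s : ℝ) ^ (k i * s) := by
        rw [Finset.prod_pow_eq_pow_sum, ← Finset.sum_mul, hN]
      have hc : (s : ℝ) ^ c = ∏ _i : ι, (s : ℝ) := by simp [c]
      rw [this, hc, ← Finset.prod_pow, ← Finset.prod_mul_distrib, ← Finset.prod_mul_distrib,
        ← Finset.prod_mul_distrib]
      refine Finset.prod_congr rfl fun i _ => ?_
      push_cast
      rw [mul_pow, pow_mul (k i : ℝ)]
      ring
    have h6 : ((N : ℝ) ^ N) ^ s * (s : ℝ) ^ (N * s) ≤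
        (P ^ s * (D * (s : ℝ) ^ c)) * (s : ℝ) ^ (N * s) :=
      calc ((N : ℝ) ^ N) ^ s * (s : ℝ) ^ (N * s) = (((N * s : ℕ) : ℝ)) ^ (N * s) := by
            push_cast
            rw [mul_pow, pow_mul (N : ℝ)]
        _ ≤ _ := h2
        _ ≤ (A ^ (N * s) * ∏ i, ((k i * s).factorial : ℝ)) * Real.exp ((N * s : ℕ) : ℝ) := by
            gcongr
            refine h1'.trans ?_
            gcongr
            exact hle _
        _ = A ^ (N * s) * ∏ i, (((k i * s).factorial : ℝ) * Real.exp ((k i * s : ℕ) : ℝ)) := by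
            rw [h3, Finset.prod_mul_distrib]
            ring
        _ ≤ A ^ (N * s) *
              ((D * (s : ℝ) ^ c) * ((∏ i, (k i : ℝ) ^ k i) ^ s * (s : ℝ) ^ (N * s))) := by
            rw [← h5]
            gcongr
        _ = _ := by
            rw [hP, mul_pow, pow_mul A]
            ring
    exact le_of_mul_le_mul_right h6 (by positivity)
  by_contra! hlt
  have hr : 1 < (N : ℝ) ^ N / P := (one_lt_div hPpos).2 hlt
  have ht := (tendsto_pow_const_div_const_pow_of_one_lt c hr).const_mul D
  rw [mul_zero] at ht
  obtain ⟨s, hs1, hs⟩ := ((ht.eventually_lt_const one_pos).and (eventually_ne_atTop 0)).exists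
  have h := main s hs
  have hb : 0 < ((N : ℝ) ^ N / P) ^ s := by positivity
  rw [mul_div_assoc', div_lt_one hb, div_pow, lt_div_iff₀ (by positivity)] at hs1
  linarith

theorem div_lt_of_numReps_self_le {ι : Type*} [Fintype ι] [DecidableEq ι] (k : ι → ℕ) (v : ι → ℤ)
    (hv : Function.Injective v) (hk : ∀ i, k i ≠ 0) (N : ℕ) (hN : ∑ i, k i = N)
    (hsq : ∑ i, k i * v i ^ 2 = (N : ℤ)) {a b : ℕ} (hb : b ≠ 0)
    (hab : a ^ N * ∏ i, k i ^ k i < b ^ N * N ^ N) {A : ℝ} (hA : 0 < A)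
    (hle : ∀ n, (numReps n n : ℝ) ≤ A ^ n) : (a / b : ℝ) < A := by
  by_contra! hAab
  have hbpos : (0 : ℝ) < b := by exact_mod_cast Nat.pos_of_ne_zero hb
  have hab' : (a : ℝ) ^ N * ∏ i, (k i : ℝ) ^ k i < (b : ℝ) ^ N * (N : ℝ) ^ N := by
    exact_mod_cast hab
  refine hab'.not_ge ?_
  calc (b : ℝ) ^ N * (N : ℝ) ^ N ≤ (b : ℝ) ^ N * (A ^ N * ∏ i, (k i : ℝ) ^ k i) := by
        gcongr
        exact pow_le_of_numReps_self_le k v hv hk N hN hsq hA hle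
    _ ≤ (b : ℝ) ^ N * ((a / b : ℝ) ^ N * ∏ i, (k i : ℝ) ^ k i) := by gcongr
    _ = (a : ℝ) ^ N * ∏ i, (k i : ℝ) ^ k i := by
        rw [← mul_assoc, ← mul_pow, mul_div_cancel₀ _ hbpos.ne']

set_option exponentiation.threshold 4000 in
theorem lower_bound_of_numReps_self_le {A : ℝ} (hA : 0 < A)
    (hle : ∀ n, (numReps n n : ℝ) ≤ A ^ n) : 4.132 < A := by
  have h := div_lt_of_numReps_self_le ![1298, 784, 784, 174, 174, 14, 14, 1, 1]
    ![0, 1, -1, 2, -2, 3, -3, 4, -4] (by decide) (by decide) 3244 (by decide) (by decide)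
    (a := 1033) (b := 250) (by decide) (by norm_num [Fin.prod_univ_succ]) hA hle
  norm_num at h ⊢
  exact h

theorem rep_nn_root_limit :
    ∃ A : ℝ, 4.132 < A ∧ A < 4.134 ∧
      Tendsto (fun n : ℕ => (numReps n (n : ℤ) : ℝ) ^ ((1 : ℝ) / n)) atTop (nhds A) := by
  have hpos : ∀ n : ℕ, (0 : ℝ) < numReps n n := fun n => by exact_mod_cast numReps_self_pos n
  set u : ℕ → ℝ := fun n => -Real.log (numReps n n) with hu
  have hsub : Subadditive u := fun m n => by
    have h : (numReps m m * numReps n n : ℝ) ≤ numReps (m + n) ((m + n : ℕ) : ℤ) := by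
      exact_mod_cast numReps_mul_le m n m n
    have := Real.log_le_log (mul_pos (hpos m) (hpos n)) h
    rw [Real.log_mul (hpos m).ne' (hpos n).ne'] at this
    simp only [hu]
    linarith
  have hup : ∀ n : ℕ, (numReps n n : ℝ) ≤ (2.48 / (3 / 5)) ^ n := fun n => by
    rw [div_pow, le_div_iff₀ (by positivity)]
    exact numReps_mul_pow_le (by norm_num) n n (sum_three_fifths_pow_sq_le n)
  have hlb : ∀ n : ℕ, -Real.log (2.48 / (3 / 5)) ≤ u n / n := fun n => by
    rcases Nat.eq_zero_or_pos n with rfl | hn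
    · simpa using Real.log_nonneg (by norm_num)
    · have := Real.log_le_log (hpos n) (hup n)
      rw [Real.log_pow] at this
      have hn' : (0 : ℝ) < n := by exact_mod_cast hn
      rw [le_div_iff₀ hn']
      simp only [hu]
      linarith
  have hbdd : BddBelow (Set.range fun n => u n / n) := ⟨_, by rintro _ ⟨n, rfl⟩; exact hlb n⟩
  have hlim := hsub.tendsto_lim hbdd
  refine ⟨Real.exp (-hsub.lim), lower_bound_of_numReps_self_le (Real.exp_pos _) fun n => ?_, ?_, ?_⟩
  · rcases Nat.eq_zero_or_pos n with rfl | hn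
    · simp [numReps]
    · have h := hsub.lim_le_div hbdd hn.ne'
      have hn' : (0 : ℝ) < n := by exact_mod_cast hn
      rw [le_div_iff₀ hn'] at h
      rw [← Real.exp_nat_mul, ← Real.log_le_iff_le_exp (hpos n)]
      simp only [hu] at h
      linarith
  · have h := ge_of_tendsto' hlim hlb
    calc Real.exp (-hsub.lim) ≤ 2.48 / (3 / 5) := by
          rw [← Real.le_log_iff_exp_le (by norm_num)]
          linarith
      _ < 4.134 := by norm_num
  · refine ((Real.continuous_exp.tendsto _).comp hlim.neg).congr fun n => ?_
    rw [Function.comp_apply, Real.rpow_def_of_pos (hpos n)]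
    congr 1
    simp only [hu]
    ring
end

section
/- Let $a$ be a positive integer. Then there exists a real number $y > 0$ such that $\sum_{n \in \mathbb{Z}} (n^2 - a)\, e^{-2\pi y (n^2 - a)} = 0$; equivalently, the function $g(z) = e^{-2\pi i a z}\,\theta(z)$ satisfies $g'(iy) = 0$. -/
open Complex

/-- The Jacobi theta function `θ(z) = ∑_{n ∈ ℤ} e^{2πi n² z}` (for `Im z > 0`). -/
noncomputable def jacobiThetaFn (z : ℂ) : ℂ :=
  ∑' n : ℤ, Complex.exp (2 * Real.pi * I * (n : ℂ) ^ 2 * z)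

lemma summable_exp_neg_sq {c : ℝ} (hc : 0 < c) :
    Summable fun n : ℤ => Real.exp (-2 * Real.pi * c * (n : ℝ) ^ 2) := by
  have h := ((summable_jacobiTheta₂_term_iff 0 ((2 * c : ℝ) * I)).2 (by simpa using hc)).norm
  refine h.congr fun n => ?_
  rw [jacobiTheta₂_term, mul_zero, zero_add, Complex.norm_exp]
  congr 1
  have : (Real.pi : ℂ) * I * (n : ℂ) ^ 2 * ((2 * c : ℝ) * I)
      = ((-2 * Real.pi * c * (n : ℝ) ^ 2 : ℝ) : ℂ) := by
    push_cast
    linear_combination (2 * Real.pi * c * n ^ 2 : ℂ) * I_mul_I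
  rw [this, ofReal_re]

/-- The `n`-th term of the series for `e^{-2πi a z} θ(z)`. -/
noncomputable def twistedThetaTerm (a n : ℤ) (z : ℂ) : ℂ :=
  Complex.exp (2 * Real.pi * I * ((n : ℂ) ^ 2 - a) * z)

lemma exp_mul_jacobiThetaFn (a : ℤ) (z : ℂ) :
    Complex.exp (-2 * Real.pi * I * (a : ℂ) * z) * jacobiThetaFn z
      = ∑' n : ℤ, twistedThetaTerm a n z := by
  rw [jacobiThetaFn, ← tsum_mul_left]
  refine tsum_congr fun n => ?_
  rw [twistedThetaTerm, ← Complex.exp_add]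
  ring_nf

lemma hasDerivAt_twistedThetaTerm (a n : ℤ) (z : ℂ) :
    HasDerivAt (twistedThetaTerm a n)
      (2 * Real.pi * I * ((n : ℂ) ^ 2 - a) * twistedThetaTerm a n z) z := by
  have h := ((hasDerivAt_id z).const_mul (2 * Real.pi * I * ((n : ℂ) ^ 2 - a))).cexp
  refine h.congr_deriv ?_
  rw [mul_one, mul_comm]
  rfl

lemma twistedThetaTerm_mul_I (a n : ℤ) (y : ℝ) :
    twistedThetaTerm a n (y * I)
      = (Real.exp (-2 * Real.pi * y * ((n : ℝ) ^ 2 - a)) : ℝ) := by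
  rw [twistedThetaTerm, ofReal_exp]
  congr 1
  push_cast
  linear_combination (2 * Real.pi * y * (n ^ 2 - a) : ℂ) * I_mul_I

lemma norm_twistedThetaTerm_le {a : ℤ} (ha : 0 < a) (n : ℤ) {c d : ℝ} {z : ℂ}
    (hc : c < z.im) (hd : z.im < d) :
    ‖twistedThetaTerm a n z‖
      ≤ Real.exp (2 * Real.pi * a * d) * Real.exp (-2 * Real.pi * c * (n : ℝ) ^ 2) := by
  have ha' : (0 : ℝ) < a := by exact_mod_cast ha
  have hre : (2 * Real.pi * I * ((n : ℂ) ^ 2 - a) * z).re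
      = -2 * Real.pi * ((n : ℝ) ^ 2 - a) * z.im := by
    have : 2 * Real.pi * I * ((n : ℂ) ^ 2 - a) * z
        = ((2 * Real.pi * ((n : ℝ) ^ 2 - a) : ℝ) : ℂ) * (I * z) := by
      push_cast; ring
    rw [this, re_ofReal_mul, I_mul_re]
    ring
  rw [twistedThetaTerm, Complex.norm_exp, hre, ← Real.exp_add, Real.exp_le_exp]
  have h1 : 0 ≤ 2 * Real.pi * (a * (d - z.im)) := by
    have := sub_pos.2 hd
    positivity
  have h2 : 0 ≤ 2 * Real.pi * ((n : ℝ) ^ 2 * (z.im - c)) := by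
    have := sub_pos.2 hc
    positivity
  linarith

lemma summable_twistedTheta_real (a : ℤ) {y : ℝ} (hy : 0 < y) :
    Summable fun n : ℤ => Real.exp (-2 * Real.pi * y * ((n : ℝ) ^ 2 - a)) := by
  refine ((summable_exp_neg_sq hy).mul_left (Real.exp (2 * Real.pi * y * a))).congr fun n => ?_
  rw [← Real.exp_add]
  ring_nf

lemma hasDerivAt_tsum_twistedThetaTerm {a : ℤ} (ha : 0 < a) {y : ℝ} (hy : 0 < y) :
    HasDerivAt (fun z => ∑' n : ℤ, twistedThetaTerm a n z)
      (2 * Real.pi * I * (∑' n : ℤ, ((n : ℝ) ^ 2 - a) *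
        Real.exp (-2 * Real.pi * y * ((n : ℝ) ^ 2 - a)) : ℝ)) (y * I) := by
  set U : Set ℂ := {z | y / 2 < z.im} ∩ {z | z.im < 2 * y}
  have hU : IsOpen U := (isOpen_lt continuous_const continuous_im).inter
    (isOpen_lt continuous_im continuous_const)
  have hyU : (y * I : ℂ) ∈ U := by
    constructor <;> simp <;> linarith
  have hu := (summable_exp_neg_sq (half_pos hy)).mul_left (Real.exp (2 * Real.pi * a * (2 * y)))
  have hdiff : ∀ n : ℤ, DifferentiableOn ℂ (twistedThetaTerm a n) U := fun n z _ =>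
    (hasDerivAt_twistedThetaTerm a n z).differentiableAt.differentiableWithinAt
  have hle : ∀ (n : ℤ) (w : ℂ), w ∈ U → ‖twistedThetaTerm a n w‖ ≤
      Real.exp (2 * Real.pi * a * (2 * y)) *
        Real.exp (-2 * Real.pi * (y / 2) * (n : ℝ) ^ 2) :=
    fun n w hw => norm_twistedThetaTerm_le ha n hw.1 hw.2
  have hsum := hasSum_deriv_of_summable_norm hu hdiff hU hle hyU
  have hd := (differentiableOn_tsum_of_summable_norm hu hdiff hU hle).differentiableAt
    (hU.mem_nhds hyU)
  refine hd.hasDerivAt.congr_deriv ?_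
  symm
  rw [← hsum.tsum_eq, ofReal_tsum, ← tsum_mul_left]
  refine tsum_congr fun n => ?_
  rw [(hasDerivAt_twistedThetaTerm a n _).deriv, twistedThetaTerm_mul_I]
  push_cast
  ring

lemma hasDerivAt_twistedTheta_real {a : ℤ} (ha : 0 < a) {y : ℝ} (hy : 0 < y) :
    HasDerivAt (fun t : ℝ => ∑' n : ℤ, Real.exp (-2 * Real.pi * t * ((n : ℝ) ^ 2 - a)))
      (-2 * Real.pi * ∑' n : ℤ, ((n : ℝ) ^ 2 - a) *
        Real.exp (-2 * Real.pi * y * ((n : ℝ) ^ 2 - a))) y := by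
  have h1 : HasDerivAt (fun z : ℂ => z * I) I (y : ℂ) := by
    simpa using (hasDerivAt_id (y : ℂ)).mul_const I
  have h2 := ((hasDerivAt_tsum_twistedThetaTerm ha hy).comp (y : ℂ) h1).real_of_complex
  refine (h2.congr_deriv ?_).congr_of_eventuallyEq (.of_forall fun t => ?_)
  · rw [mul_right_comm, mul_assoc _ I I, I_mul_I, re_mul_ofReal]
    simp
  · simp only [Function.comp_apply, twistedThetaTerm_mul_I]
    rw [← ofReal_tsum, ofReal_re]

lemma exists_isLocalMin_twistedTheta_real {a : ℤ} (ha : 0 < a) :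
    ∃ y : ℝ, 0 < y ∧
      IsLocalMin (fun t : ℝ => ∑' n : ℤ, Real.exp (-2 * Real.pi * t * ((n : ℝ) ^ 2 - a))) y := by
  set g : ℝ → ℝ := fun t => ∑' n : ℤ, Real.exp (-2 * Real.pi * t * ((n : ℝ) ^ 2 - a)) with hg
  have ha' : (1 : ℝ) ≤ a := by exact_mod_cast ha
  have hlower : ∀ (s : Finset ℤ) (t : ℝ), 0 < t →
      ∑ n ∈ s, Real.exp (-2 * Real.pi * t * ((n : ℝ) ^ 2 - a)) ≤ g t := fun s t ht =>
    (summable_twistedTheta_real a ht).sum_le_tsum s fun _ _ => (Real.exp_pos _).le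
  have hlarge : ∀ t : ℝ, 0 < t → t < g t := fun t ht => by
    have h := hlower {0} t ht
    rw [Finset.sum_singleton] at h
    have h1 := Real.add_one_le_exp (-2 * Real.pi * t * (((0 : ℤ) : ℝ) ^ 2 - a))
    have h2 : t * 1 ≤ t * (2 * Real.pi * a) := by
      gcongr
      nlinarith [Real.pi_gt_three]
    push_cast at h h1
    linarith
  obtain ⟨N, hN⟩ := exists_nat_gt (g 1)
  obtain ⟨s, hs⟩ := Infinite.exists_subset_card_eq ℤ N
  have hsmall : ∀ᶠ t in nhds (0 : ℝ),
      g 1 < ∑ n ∈ s, Real.exp (-2 * Real.pi * t * ((n : ℝ) ^ 2 - a)) := by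
    have hcont : Continuous fun t : ℝ =>
        ∑ n ∈ s, Real.exp (-2 * Real.pi * t * ((n : ℝ) ^ 2 - a)) := by fun_prop
    refine hcont.continuousAt.eventually_const_lt ?_
    simpa [hs] using hN
  obtain ⟨ε, hε, hball⟩ := Metric.eventually_nhds_iff.1 hsmall
  set δ := min (ε / 2) 1
  have hδ : 0 < δ := by positivity
  have hgδ : g 1 < g δ := by
    refine (hball ?_).trans_le (hlower s δ hδ)
    rw [Real.dist_eq, sub_zero, abs_of_pos hδ]
    exact (min_le_left _ _).trans_lt (half_lt_self hε)
  have h1M : (1 : ℝ) < g 1 := hlarge 1 one_pos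
  have hgM : g 1 < g (g 1) := hlarge _ (by linarith)
  have hcont : ContinuousOn g (Set.Icc δ (g 1)) := fun t ht =>
    (hasDerivAt_twistedTheta_real ha (hδ.trans_le ht.1)).continuousAt.continuousWithinAt
  have h1 : (1 : ℝ) ∈ Set.Icc δ (g 1) := ⟨min_le_right _ _, h1M.le⟩
  obtain ⟨y, hy, hmin⟩ := isCompact_Icc.exists_isMinOn ⟨1, h1⟩ hcont
  have hy1 : g y ≤ g 1 := hmin h1
  have hyδ : δ < y := lt_of_le_of_ne hy.1 fun h => by rw [← h] at hy1; linarith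
  have hyM : y < g 1 := lt_of_le_of_ne hy.2 fun h => by
    rw [h] at hy1
    linarith
  exact ⟨y, hδ.trans hyδ, hmin.isLocalMin (Icc_mem_nhds hyδ hyM)⟩

theorem exists_saddle_point (a : ℤ) (ha : 0 < a) :
    ∃ y : ℝ, 0 < y ∧
      (∑' n : ℤ, ((n : ℝ) ^ 2 - a) * Real.exp (-2 * Real.pi * y * ((n : ℝ) ^ 2 - a))) = 0 ∧
      deriv (fun z : ℂ => Complex.exp (-2 * Real.pi * I * (a : ℂ) * z) * jacobiThetaFn z)
        (y * I) = 0 := by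
  obtain ⟨y, hy, hmin⟩ := exists_isLocalMin_twistedTheta_real ha
  have hzero := hmin.hasDerivAt_eq_zero (hasDerivAt_twistedTheta_real ha hy)
  have hsum := (mul_eq_zero.1 hzero).resolve_left (by simp [Real.pi_ne_zero])
  refine ⟨y, hy, hsum, ?_⟩
  simp only [exp_mul_jacobiThetaFn]
  rw [(hasDerivAt_tsum_twistedThetaTerm ha hy).deriv, hsum, ofReal_zero, mul_zero]
end

section
/- Let $a$ be a positive integer and $y > 0$ a real number, and let $g(z) = e^{-2\pi i a z}\,\theta(z)$. Then the second complex derivative satisfies $g''(iy) = -4\pi^2 \sum_{n \in \mathbb{Z}} (n^2 - a)^2 e^{-2\pi y (n^2 - a)}$; in particular, $g''(iy)$ is a negative real number. -/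
open Complex

/-- If `∑ ‖exp (c n z)‖` is locally uniformly dominated on an open set, then the second derivative
of `∑ exp (c n z)` may be computed termwise. -/
theorem hasSum_deriv_deriv_exp {ι : Type*} {c : ι → ℂ} {u : ι → ℝ} (hu : Summable u) {U : Set ℂ}
    (hU : IsOpen U) (hcu : ∀ n, ∀ w ∈ U, ‖Complex.exp (c n * w)‖ ≤ u n) {z : ℂ} (hz : z ∈ U) :
    HasSum (fun n => c n ^ 2 * Complex.exp (c n * z))
      (deriv (deriv fun w => ∑' n, Complex.exp (c n * w)) z) := by
  have hterm (n : ι) (k : ℕ) (w : ℂ) : HasDerivAt (fun w => c n ^ k * Complex.exp (c n * w))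
      (c n ^ (k + 1) * Complex.exp (c n * w)) w := by
    refine (((hasDerivAt_id' w).const_mul (c n)).cexp.const_mul (c n ^ k)).congr_deriv ?_
    ring
  have hsum (s : Finset ι) (k : ℕ) : deriv (fun w => ∑ n ∈ s, c n ^ k * Complex.exp (c n * w)) =
      fun w => ∑ n ∈ s, c n ^ (k + 1) * Complex.exp (c n * w) :=
    funext fun w => (HasDerivAt.fun_sum fun n _ => hterm n k w).deriv
  have hdiff (s : Finset ι) (k : ℕ) :
      DifferentiableOn ℂ (fun w => ∑ n ∈ s, c n ^ k * Complex.exp (c n * w)) U := fun w _ =>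
    (HasDerivAt.fun_sum fun n _ => hterm n k w).differentiableAt.differentiableWithinAt
  have h0 : TendstoLocallyUniformlyOn
      (fun (s : Finset ι) w => ∑ n ∈ s, c n ^ 0 * Complex.exp (c n * w))
      (fun w => ∑' n, Complex.exp (c n * w)) Filter.atTop U := by
    simpa only [pow_zero, one_mul] using
      (tendstoUniformlyOn_tsum hu hcu).tendstoLocallyUniformlyOn
  have h1 := h0.deriv (Filter.Eventually.of_forall fun s => hdiff s 0) hU
  simp only [Function.comp_def, hsum] at h1
  have h2 := h1.deriv (Filter.Eventually.of_forall fun s => hdiff s 1) hU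
  simp only [Function.comp_def, hsum] at h2
  exact h2.tendsto_at hz

theorem summable_exp_neg_pi_mul_sq {t : ℝ} (ht : 0 < t) :
    Summable fun n : ℤ => Real.exp (-Real.pi * (n : ℝ) ^ 2 * t) := by
  have h := ((summable_jacobiTheta₂_term_iff 0 (t * I)).2 (by simpa using ht)).norm
  simpa [norm_jacobiTheta₂_term] using h

theorem second_deriv_negative (a : ℤ) (ha : 0 < a) (y : ℝ) (hy : 0 < y)
    (g : ℂ → ℂ)
    (hg : g = fun z : ℂ => Complex.exp (-2 * Real.pi * I * (a : ℂ) * z) * jacobiThetaFn z) :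
    deriv (deriv g) (y * I) =
        -4 * (Real.pi : ℂ) ^ 2 *
          ∑' n : ℤ, ((((n : ℝ) ^ 2 - a) ^ 2 * Real.exp (-2 * Real.pi * y * ((n : ℝ) ^ 2 - a)) : ℝ) : ℂ)
      ∧ (deriv (deriv g) (y * I)).im = 0 ∧ (deriv (deriv g) (y * I)).re < 0 := by
  have hg' : g = fun z : ℂ => ∑' n : ℤ,
      Complex.exp (2 * Real.pi * I * ((n : ℂ) ^ 2 - a) * z) := by
    subst hg
    funext z
    rw [jacobiThetaFn, ← tsum_mul_left]
    refine tsum_congr fun n => ?_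
    rw [← Complex.exp_add]
    ring_nf
  set r : ℤ → ℝ := fun n =>
    ((n : ℝ) ^ 2 - a) ^ 2 * Real.exp (-2 * Real.pi * y * ((n : ℝ) ^ 2 - a)) with hr
  have ha' : (0 : ℝ) < a := by exact_mod_cast ha
  have hπ := Real.pi_pos
  have hU : IsOpen {w : ℂ | y / 2 < w.im ∧ w.im < 2 * y} :=
    (isOpen_lt continuous_const continuous_im).inter (isOpen_lt continuous_im continuous_const)
  have hH := hasSum_deriv_deriv_exp
    (c := fun n : ℤ => 2 * Real.pi * I * ((n : ℂ) ^ 2 - a))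
    (u := fun n : ℤ => Real.exp (4 * Real.pi * a * y) * Real.exp (-Real.pi * (n : ℝ) ^ 2 * y))
    ((summable_exp_neg_pi_mul_sq hy).mul_left _) hU (z := y * I) ?_ ?_
  · rw [← hg'] at hH
    have hterm (n : ℤ) : (2 * Real.pi * I * ((n : ℂ) ^ 2 - a)) ^ 2 *
        Complex.exp (2 * Real.pi * I * ((n : ℂ) ^ 2 - a) * (y * I)) =
        ((-4 * Real.pi ^ 2 * r n : ℝ) : ℂ) := by
      have he : 2 * Real.pi * I * ((n : ℂ) ^ 2 - a) * (y * I) =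
          -2 * Real.pi * y * ((n : ℂ) ^ 2 - a) := by
        linear_combination (2 * Real.pi * y * ((n : ℂ) ^ 2 - a)) * I_sq
      rw [he, hr]
      push_cast
      linear_combination (4 * (Real.pi : ℂ) ^ 2 * ((n : ℂ) ^ 2 - a) ^ 2 *
        Complex.exp (-2 * Real.pi * y * ((n : ℂ) ^ 2 - a))) * I_sq
    simp only [hterm] at hH
    have hs : Summable r := by
      have hC : (-4 * Real.pi ^ 2 : ℝ) ≠ 0 := by simp [hπ.ne']
      exact (summable_mul_left_iff hC).1 (Complex.summable_ofReal.1 hH.summable)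
    have hpos : 0 < ∑' n, r n := by
      refine hs.tsum_pos (fun n => by positivity) 0 ?_
      simp only [hr, Int.cast_zero]
      have : ((0 : ℝ) ^ 2 - a) ≠ 0 := by simpa using ha.ne'
      positivity
    have hval : deriv (deriv g) (y * I) = ((-4 * Real.pi ^ 2 * ∑' n, r n : ℝ) : ℂ) := by
      rw [← hH.tsum_eq, ← Complex.ofReal_tsum, tsum_mul_left]
    refine ⟨?_, ?_, ?_⟩
    · rw [hval, ← Complex.ofReal_tsum]
      simp only [ofReal_mul, ofReal_neg, ofReal_pow, ofReal_ofNat, hr]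
    · rw [hval, ofReal_im]
    · rw [hval, ofReal_re]
      have : 0 < Real.pi ^ 2 * ∑' n, r n := by positivity
      linarith
  · rintro n w ⟨hw1, hw2⟩
    rw [Complex.norm_exp, ← Real.exp_add, Real.exp_le_exp]
    have he : (2 * Real.pi * I * ((n : ℂ) ^ 2 - a) * w).re =
        -2 * Real.pi * ((n : ℝ) ^ 2 - a) * w.im := by
      have : 2 * Real.pi * I * ((n : ℂ) ^ 2 - a) * w =
          ((2 * Real.pi * ((n : ℝ) ^ 2 - a) : ℝ) : ℂ) * (I * w) := by
        push_cast
        ring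
      rw [this, re_ofReal_mul, I_mul_re]
      ring
    rw [he]
    have h1 := mul_le_mul_of_nonneg_left hw1.le (by positivity : 0 ≤ 2 * Real.pi * (n : ℝ) ^ 2)
    have h2 := mul_le_mul_of_nonneg_left hw2.le (by positivity : 0 ≤ 2 * Real.pi * (a : ℝ))
    linarith
  · constructor <;> simp <;> linarith
end

section
/- Let $a$ be a positive integer and define $G : (0,\infty) \to \mathbb{R}$ by $G(y) = \sum_{n \in \mathbb{Z}} (n^2 - a)\, e^{-2\pi y (n^2 - a)}$. Then $G(y) \to +\infty$ as $y \to 0^+$ and $G(y) \to -\infty$ as $y \to \infty$. -/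
open Filter

/-- The series `∑ (n² - a) exp (-2πy(n² - a))` over the integers converges for `y > 0`. -/
lemma summable_int_sq_sub_mul_exp (a : ℝ) {y : ℝ} (hy : 0 < y) :
    Summable fun n : ℤ =>
      ((n : ℝ) ^ 2 - a) * Real.exp (-2 * Real.pi * y * ((n : ℝ) ^ 2 - a)) := by
  have h2 := HurwitzKernelBounds.summable_f_int 2 0 (t := 2 * y) (by positivity)
  have h0 := HurwitzKernelBounds.summable_f_int 0 0 (t := 2 * y) (by positivity)
  refine ((h2.sub (h0.mul_left a)).mul_left (Real.exp (2 * Real.pi * y * a))).congr fun n => ?_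
  have hexp : Real.exp (-2 * Real.pi * y * ((n : ℝ) ^ 2 - a)) =
      Real.exp (2 * Real.pi * y * a) * Real.exp (-Real.pi * (n : ℝ) ^ 2 * (2 * y)) := by
    rw [← Real.exp_add]
    ring_nf
  simp only [HurwitzKernelBounds.f_int, hexp, add_zero, sq_abs, pow_zero]
  ring

/-- For every real `c`, the function `y ↦ c * exp (-2πyc)` is antitone. -/
lemma antitone_mul_exp_neg_two_pi_mul (c : ℝ) :
    Antitone fun y : ℝ => c * Real.exp (-2 * Real.pi * y * c) := by
  intro x y hxy
  have h : 0 ≤ Real.pi * (y - x) := mul_nonneg Real.pi_pos.le (sub_nonneg.2 hxy)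
  rcases le_total 0 c with hc | hc
  · refine mul_le_mul_of_nonneg_left (Real.exp_le_exp.2 ?_) hc
    nlinarith [mul_nonneg h hc]
  · refine mul_le_mul_of_nonpos_left (Real.exp_le_exp.2 ?_) hc
    nlinarith [mul_nonneg h (neg_nonneg.2 hc)]

/-- Finite sums of `n² - a` over sets of integers containing `[-a, a]` are arbitrarily large. -/
lemma exists_finset_lt_sum_int_sq_sub {a : ℤ} (ha : 0 < a) (M : ℝ) :
    ∃ F : Finset ℤ, (∀ n ∉ F, (0 : ℝ) ≤ (n : ℝ) ^ 2 - a) ∧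
      M < ∑ n ∈ F, ((n : ℝ) ^ 2 - a) := by
  set C : ℝ := ∑ n ∈ Finset.Icc (-a) a, ((n : ℝ) ^ 2 - a)
  obtain ⟨K, hK⟩ := exists_nat_gt (M - C)
  have hdisj : Disjoint (Finset.Icc (-a) a) (Finset.Ioc a (a + K)) := by
    rw [Finset.disjoint_left]
    intro n hn hn'
    simp only [Finset.mem_Icc, Finset.mem_Ioc] at hn hn'
    omega
  refine ⟨Finset.Icc (-a) a ∪ Finset.Ioc a (a + K), fun n hn => ?_, ?_⟩
  · have hn : ¬ (-a ≤ n ∧ n ≤ a) := fun h =>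
      hn (Finset.mem_union_left _ (Finset.mem_Icc.2 h))
    have : 0 ≤ n ^ 2 - a := by
      rcases not_and_or.1 hn with h | h <;> nlinarith
    exact_mod_cast this
  · rw [Finset.sum_union hdisj]
    have h := Finset.card_nsmul_le_sum (Finset.Ioc a (a + K)) (fun n : ℤ => (n : ℝ) ^ 2 - a) 1
      fun n hn => by
        have hn := (Finset.mem_Ioc.1 hn).1
        have : 1 ≤ n ^ 2 - a := by nlinarith
        exact_mod_cast this
    simp only [Int.card_Ioc, add_sub_cancel_left, Int.toNat_natCast, nsmul_eq_mul, mul_one] at h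
    linarith

theorem saddle_sum_limits (a : ℤ) (ha : 0 < a) :
    Tendsto (fun y : ℝ => ∑' n : ℤ, ((n : ℝ) ^ 2 - a) * Real.exp (-2 * Real.pi * y * ((n : ℝ) ^ 2 - a)))
        (nhdsWithin 0 (Set.Ioi 0)) atTop ∧
      Tendsto (fun y : ℝ => ∑' n : ℤ, ((n : ℝ) ^ 2 - a) * Real.exp (-2 * Real.pi * y * ((n : ℝ) ^ 2 - a)))
        atTop atBot := by
  constructor
  · rw [tendsto_atTop]
    intro M
    obtain ⟨F, hF, hM⟩ := exists_finset_lt_sum_int_sq_sub ha M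
    have hcont : Continuous fun y : ℝ => ∑ n ∈ F,
        ((n : ℝ) ^ 2 - a) * Real.exp (-2 * Real.pi * y * ((n : ℝ) ^ 2 - a)) := by fun_prop
    have hev := (hcont.tendsto 0).eventually_const_lt (u := M) (by
      simpa only [mul_zero, zero_mul, Real.exp_zero, mul_one] using hM)
    filter_upwards [nhdsWithin_le_nhds hev, self_mem_nhdsWithin] with y hy hpos
    exact hy.le.trans ((summable_int_sq_sub_mul_exp a hpos).sum_le_tsum F
      fun n hn => mul_nonneg (hF n hn) (Real.exp_pos _).le)
  · have ha' : (0 : ℝ) < a := by exact_mod_cast ha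
    set f : ℝ → ℤ → ℝ := fun y n =>
      ((n : ℝ) ^ 2 - a) * Real.exp (-2 * Real.pi * y * ((n : ℝ) ^ 2 - a)) with hf
    have hzero : Tendsto (fun y => f y 0) atTop atBot := by
      have hexp : Tendsto (fun y : ℝ => Real.exp (2 * Real.pi * a * y)) atTop atTop :=
        Real.tendsto_exp_atTop.comp (tendsto_id.const_mul_atTop (by positivity))
      refine (hexp.const_mul_atTop_of_neg (neg_lt_zero.2 ha')).congr fun y => ?_
      simp only [hf, Int.cast_zero]
      ring_nf
    refine tendsto_atBot_mono' atTop ?_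
      (tendsto_atBot_add_const_right atTop ((∑' n, f 1 n) - f 1 0) hzero)
    filter_upwards [eventually_ge_atTop 1] with y hy
    have hs1 : Summable (f 1) := summable_int_sq_sub_mul_exp a one_pos
    have hsy : Summable (f y) := summable_int_sq_sub_mul_exp a (one_pos.trans_le hy)
    have h := (hs1.sub hsy).le_tsum 0
      fun n _ => sub_nonneg.2 (antitone_mul_exp_neg_two_pi_mul ((n : ℝ) ^ 2 - a) hy)
    rw [hs1.tsum_sub hsy] at h
    change ∑' n, f y n ≤ _
    linarith
end
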